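/- For m ≥ 1 and n ≥ 0, let H ⊆ U(n+m) be the subgroup of block-diagonal matrices with blocks I_n and A for A ∈ U(m). Then the left coset space U(n+m)/H, with the quotient topology, is simply connected (i.e., path connected with trivial fundamental group). -/

import Mathlib

/-- The subgroup of `U(n+m)` of block-diagonal matrices with blocks `I_n` and `A`,
for `A ∈ U(m)`, as a subset. -/
def blockDiagUnitary (n m : ℕ) : Set (Matrix.unitaryGroup (Fin (n + m)) ℂ) :=
  {U | ∃ A : Matrix.unitaryGroup (Fin m) ℂ, ∀ i j : Fin (n + m),
    (U : Matrix (Fin (n + m)) (Fin (n + m)) ℂ) i j =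
      if hi : (i : ℕ) < n then (if (i : ℕ) = (j : ℕ) then 1 else 0)
      else if hj : (j : ℕ) < n then 0
      else (A : Matrix (Fin m) (Fin m) ℂ)
        ⟨(i : ℕ) - n, by have := i.isLt; omega⟩
        ⟨(j : ℕ) - n, by have := j.isLt; omega⟩}

/-- The relation on `U(n+m)` identifying `g` with `g·h` for `h` in the block subgroup `H`;
its quotient is the coset space `U(n+m)/H`, i.e. the complex Stiefel manifold, with the
quotient topology. -/
def stiefelRel (n m : ℕ) (g g' : Matrix.unitaryGroup (Fin (n + m)) ℂ) : Prop :=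
  ∃ h ∈ blockDiagUnitary n m, g' = g * h

section SimplyConnected

open Set unitInterval Topology

theorem Path.Homotopic.of_mem_of_isSimplyConnected {X : Type*} [TopologicalSpace X] {U : Set X}
    (hU : IsSimplyConnected U) {x y : X} (p q : Path x y) (hp : ∀ t, p t ∈ U)
    (hq : ∀ t, q t ∈ U) : p.Homotopic q := by
  have := hU.simplyConnectedSpace
  have hx : x ∈ U := by simpa using hp 0
  have hy : y ∈ U := by simpa using hp 1
  let lift (r : Path x y) (hr : ∀ t, r t ∈ U) : Path (⟨x, hx⟩ : U) ⟨y, hy⟩ :=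
    { toFun := fun t => ⟨r t, hr t⟩
      source' := by simp
      target' := by simp }
  exact (SimplyConnectedSpace.paths_homotopic (lift p hp) (lift q hq)).map
    ⟨Subtype.val, continuous_subtype_val⟩

/-- A weak form of the Seifert–van Kampen theorem: a space covered by simply connected open sets
with a common point and path connected pairwise intersections is simply connected. -/
theorem SimplyConnectedSpace.of_iUnion_eq_univ {X ι : Type*} [TopologicalSpace X] {W : ι → Set X}
    (hopen : ∀ i, IsOpen (W i)) (hcover : ⋃ i, W i = univ)
    (hsc : ∀ i, IsSimplyConnected (W i))
    (hpc : Pairwise fun i j => IsPathConnected (W i ∩ W j))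
    {x₀ : X} (hx₀ : ∀ i, x₀ ∈ W i) : SimplyConnectedSpace X := by
  have hcov (x : X) : ∃ i, x ∈ W i := by simpa using hcover.ge (mem_univ x)
  have hclass (x : X) : ∃ c : Path.Homotopic.Quotient x₀ x,
      ∀ i (p : Path x₀ x), (∀ t, p t ∈ W i) → .mk p = c := by
    obtain ⟨i, hi⟩ := hcov x
    obtain ⟨p, hp⟩ := (hsc i).isPathConnected.joinedIn _ (hx₀ i) _ hi
    refine ⟨.mk p, fun j q hq => Path.Homotopic.Quotient.eq.2 ?_⟩
    rcases eq_or_ne i j with rfl | hij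
    · exact .of_mem_of_isSimplyConnected (hsc i) q p hq hp
    · have hj : x ∈ W j := by simpa using hq 1
      obtain ⟨r, hr⟩ := (hpc hij).joinedIn _ ⟨hx₀ i, hx₀ j⟩ _ ⟨hi, hj⟩
      exact (Path.Homotopic.of_mem_of_isSimplyConnected (hsc j) q r hq fun t => (hr t).2).trans
        (.of_mem_of_isSimplyConnected (hsc i) r p (fun t => (hr t).1) hp)
  choose c hc using hclass
  have hstep {x y : X} (i : ι) (p : Path x y) (hp : ∀ t, p t ∈ W i) :
      (c x).trans (.mk p) = c y := by
    obtain ⟨q, hq⟩ := (hsc i).isPathConnected.joinedIn _ (hx₀ i) _ (by simpa using hp 0)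
    rw [← hc x i q hq, ← Path.Homotopic.Quotient.mk_trans]
    refine hc y i _ fun t => ?_
    rw [Path.trans_apply]
    split_ifs
    exacts [hq _, hp _]
  have hpath {x y : X} (p : Path x y) : (c x).trans (.mk p) = c y := by
    obtain ⟨t, ht₀, hmono, ⟨n, hn⟩, hsub⟩ :=
      exists_monotone_Icc_subset_open_cover_unitInterval (c := fun i => p ⁻¹' W i)
        (fun i => (hopen i).preimage p.continuous)
        (by rw [← preimage_iUnion, hcover, preimage_univ])
    have key (k : ℕ) : (c (p (t 0))).trans (.mk (p.subpath (t 0) (t k))) = c (p (t k)) := by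
      induction k with
      | zero => rw [Path.subpath_self]; simp
      | succ k ih =>
        obtain ⟨i, hi⟩ := hsub k
        rw [← Path.Homotopic.Quotient.eq.2 ⟨Path.Homotopy.subpathTransSubpath p _ (t k) _⟩,
          Path.Homotopic.Quotient.mk_trans, ← Path.Homotopic.Quotient.trans_assoc, ih]
        refine hstep i _ fun s => ?_
        have := mem_range_self (f := p.subpath (t k) (t (k + 1))) s
        rw [Path.range_subpath_of_le _ _ _ (hmono k.le_succ)] at this
        exact image_subset_iff.2 hi this
    have h := key n
    rw [ht₀, hn n le_rfl, Path.subpath_zero_one] at h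
    have hcast {a b : X} (ha : a = x) (hb : b = y)
        (h : (c a).trans (.mk (p.cast ha hb)) = c b) : (c x).trans (.mk p) = c y := by
      subst ha hb
      exact h
    exact hcast _ _ h
  refine simply_connected_iff_paths_homotopic.2 ⟨⟨⟨x₀⟩, fun x y => ?_⟩, fun x y => ⟨?_⟩⟩
  · exact ⟨((c x).symm.trans (c y)).out⟩
  · refine Path.Homotopic.Quotient.ind fun p => Path.Homotopic.Quotient.ind fun q => ?_
    have h : (c x).symm.trans ((c x).trans (.mk p)) = (c x).symm.trans ((c x).trans (.mk q)) := by
      rw [hpath, hpath]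
    simpa [← Path.Homotopic.Quotient.trans_assoc] using h

theorem SimplyConnectedSpace.prod_of_contractibleSpace (X Y : Type*) [TopologicalSpace X]
    [TopologicalSpace Y] [ContractibleSpace X] [SimplyConnectedSpace Y] :
    SimplyConnectedSpace (X × Y) :=
  (((ContractibleSpace.hequiv X Unit).some.prodCongr (.refl Y)).trans
    (Homeomorph.punitProd Y).toHomotopyEquiv).simplyConnectedSpace

section Sphere
open Metric Module
variable {E : Type*} [NormedAddCommGroup E] [InnerProductSpace ℝ E]

theorem contractibleSpace_compl_singleton_sphere (e : sphere (0 : E) 1) :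
    ContractibleSpace ({e}ᶜ : Set (sphere (0 : E) 1)) := by
  have h := (stereographic (norm_eq_of_mem_sphere e)).toHomeomorphSourceTarget
  simp only [stereographic_source, stereographic_target] at h
  exact (h.trans (Homeomorph.Set.univ _)).contractibleSpace

theorem isPathConnected_compl_pair_neg_sphere (hE : 2 < finrank ℝ E) (e : sphere (0 : E) 1) :
    IsPathConnected ({e, -e}ᶜ : Set (sphere (0 : E) 1)) := by
  have he := norm_eq_of_mem_sphere e
  have hrank : 1 < Module.rank ℝ (ℝ ∙ (e : E))ᗮ := by
    have : Fact (finrank ℝ E = (finrank ℝ E - 1) + 1) := ⟨by omega⟩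
    apply lt_rank_of_lt_finrank
    rw [Submodule.finrank_orthogonal_span_singleton (n := finrank ℝ E - 1)
      (ne_zero_of_mem_unit_sphere e)]
    omega
  have hemb := isOpenEmbedding_stereographic_symm he
  have h := (isPathConnected_compl_singleton_of_one_lt_rank hrank 0).image hemb.continuous
  have h0 : (stereographic he).symm 0 = -e := by
    rw [← stereographic_apply_neg e]
    refine (stereographic he).left_inv ?_
    simp [(ne_neg_of_mem_unit_sphere ℝ e).symm]
  rw [image_compl_eq_range_sdiff_image hemb.injective, image_singleton, h0,
    range_stereographic_symm he e.2] at h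
  convert h using 1
  ext x
  simp
end Sphere

section Frames
open Metric Module
open scoped InnerProductSpace ComplexConjugate

variable {E : Type*} [NormedAddCommGroup E] [InnerProductSpace ℂ E]

/-- The complex reflection along `x - e` that sends the unit vector `e` to the unit vector `x`;
it is the identity if `x = e`. -/
noncomputable def unitReflection (e x y : E) : E :=
  y - ((1 - ⟪x, e⟫_ℂ)⁻¹ * ⟪x - e, y⟫_ℂ) • (x - e)

theorem unitReflection_coeff {e x : E} (he : ‖e‖ = 1) (hx : ‖x‖ = 1) :
    (1 - ⟪x, e⟫_ℂ)⁻¹ + (1 - ⟪e, x⟫_ℂ)⁻¹ =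
      (1 - ⟪x, e⟫_ℂ)⁻¹ * (1 - ⟪e, x⟫_ℂ)⁻¹ * ⟪x - e, x - e⟫_ℂ := by
  have hconj : 1 - ⟪e, x⟫_ℂ = conj (1 - ⟪x, e⟫_ℂ) := by simp
  have hinner : ⟪x - e, x - e⟫_ℂ = (1 - ⟪x, e⟫_ℂ) + (1 - ⟪e, x⟫_ℂ) := by
    rw [inner_sub_left, inner_sub_right, inner_sub_right, inner_self_eq_norm_sq_to_K,
      inner_self_eq_norm_sq_to_K, he, hx]
    norm_num
    ring
  by_cases h : 1 - ⟪x, e⟫_ℂ = 0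
  · simp [hconj, h]
  · have h' : 1 - ⟪e, x⟫_ℂ ≠ 0 := by rwa [hconj, Ne, map_eq_zero]
    rw [hinner]
    field_simp
    ring

theorem inner_unitReflection {e x : E} (he : ‖e‖ = 1) (hx : ‖x‖ = 1) (y z : E) :
    ⟪unitReflection e x y, unitReflection e x z⟫_ℂ = ⟪y, z⟫_ℂ := by
  have h := unitReflection_coeff he hx
  simp only [unitReflection]
  generalize hu : x - e = u at *
  simp only [inner_sub_left (𝕜 := ℂ) (y : E) (_ • u), inner_sub_right (𝕜 := ℂ) _ z (_ • u),
    inner_smul_left, inner_smul_right, map_mul, map_inv₀, map_sub, map_one, inner_conj_symm]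
  linear_combination (-⟪u, z⟫_ℂ * ⟪y, u⟫_ℂ) * h

theorem unitReflection_unitReflection {e x : E} (he : ‖e‖ = 1) (hx : ‖x‖ = 1) (y : E) :
    unitReflection x e (unitReflection e x y) = y := by
  have h := unitReflection_coeff he hx
  have hneg : e - x = -(x - e) := (neg_sub x e).symm
  simp only [unitReflection, hneg]
  generalize x - e = u at *
  simp only [inner_neg_left, inner_sub_right (𝕜 := ℂ) _ y (_ • u), inner_smul_right]
  match_scalars
  · simp
  · linear_combination (-⟪u, y⟫_ℂ) * h

theorem unitReflection_self {e x : E} (he : ‖e‖ = 1) (hx : ‖x‖ = 1) :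
    unitReflection e x e = x := by
  by_cases h : ⟪x, e⟫_ℂ = 1
  · rw [inner_eq_one_iff_of_norm_eq_one hx he] at h
    simp [unitReflection, h]
  · have h' : ⟪x - e, e⟫_ℂ = -(1 - ⟪x, e⟫_ℂ) := by
      rw [inner_sub_left, inner_self_eq_norm_sq_to_K, he]; simp
    rw [unitReflection, h', mul_neg, inv_mul_cancel₀ (sub_ne_zero.2 (Ne.symm h))]
    simp

theorem continuousAt_unitReflection {e x y : E} (he : ‖e‖ = 1) (hx : ‖x‖ = 1) (hne : x ≠ e) :
    ContinuousAt (fun p : E × E × E => unitReflection p.1 p.2.1 p.2.2) (e, x, y) := by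
  have h : 1 - ⟪x, e⟫_ℂ ≠ 0 := by
    rwa [sub_ne_zero, ne_comm, Ne, inner_eq_one_iff_of_norm_eq_one hx he]
  unfold unitReflection
  fun_prop (disch := exact h)

/-- The complex Stiefel manifold of orthonormal `n`-frames in `E`. -/
abbrev OrthonormalFrame (n : ℕ) (E : Type*) [NormedAddCommGroup E] [InnerProductSpace ℂ E] :=
  {v : Fin n → E // Orthonormal ℂ v}

theorem Orthonormal.unitReflection {ι : Type*} {e x : E} (he : ‖e‖ = 1) (hx : ‖x‖ = 1)
    {v : ι → E} (hv : Orthonormal ℂ v) : Orthonormal ℂ fun i => unitReflection e x (v i) := by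
  classical
  rw [orthonormal_iff_ite] at hv ⊢
  simpa only [inner_unitReflection he hx] using hv

/-- An orthonormal `(n + 1)`-frame amounts to its first vector `x` and an orthonormal `n`-frame
of the orthogonal complement of a fixed unit vector `e`, transported by the reflection
sending `e` to `x`. -/
noncomputable def orthonormalFrameSuccEquiv (n : ℕ) (e : sphere (0 : E) 1) :
    sphere (0 : E) 1 × OrthonormalFrame n (ℂ ∙ (e : E))ᗮ ≃ OrthonormalFrame (n + 1) E where
  toFun p := ⟨fun i =>
      unitReflection (e : E) p.1 (Matrix.vecCons (e : E) (fun j => (p.2.1 j : E)) i),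
    .unitReflection (norm_eq_of_mem_sphere e) (norm_eq_of_mem_sphere p.1) <|
      orthonormal_vecCons_iff.2 ⟨norm_eq_of_mem_sphere e,
        fun i => Submodule.mem_orthogonal_singleton_iff_inner_right.1 (p.2.1 i).2,
        p.2.2.comp_linearIsometry (Submodule.subtypeₗᵢ _)⟩⟩
  invFun v := (⟨v.1 0, by simpa using v.2.1 0⟩,
    ⟨fun i => ⟨unitReflection (v.1 0) e (v.1 i.succ), by
      have he := norm_eq_of_mem_sphere e
      rw [Submodule.mem_orthogonal_singleton_iff_inner_right]
      nth_rw 1 [← unitReflection_self (v.2.1 0) he]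
      rw [inner_unitReflection (v.2.1 0) he]
      exact v.2.2 (Fin.succ_ne_zero i).symm⟩, by
      have h := (v.2.comp _ (Fin.succ_injective n)).unitReflection (v.2.1 0)
        (norm_eq_of_mem_sphere e)
      rwa [← (Submodule.subtypeₗᵢ (ℂ ∙ (e : E))ᗮ).orthonormal_comp_iff]⟩)
  left_inv p := by
    have he := norm_eq_of_mem_sphere e
    have hx := norm_eq_of_mem_sphere p.1
    ext i
    · simp [unitReflection_self he hx]
    · simp [unitReflection_self he hx, unitReflection_unitReflection he hx]
  right_inv v := by
    have he := norm_eq_of_mem_sphere e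
    ext i
    refine Fin.cases ?_ (fun i => ?_) i
    · simp [unitReflection_self he (v.2.1 0)]
    · simp [unitReflection_unitReflection (v.2.1 0) he]

theorem orthonormalFrameSuccEquiv_zero (n : ℕ) (e : sphere (0 : E) 1)
    (p : sphere (0 : E) 1 × OrthonormalFrame n (ℂ ∙ (e : E))ᗮ) :
    (orthonormalFrameSuccEquiv n e p).1 0 = p.1 :=
  unitReflection_self (norm_eq_of_mem_sphere e) (norm_eq_of_mem_sphere p.1)

theorem continuousOn_orthonormalFrameSuccEquiv (n : ℕ) (e : sphere (0 : E) 1) :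
    ContinuousOn (orthonormalFrameSuccEquiv n e) ({e}ᶜ ×ˢ univ) := by
  rintro ⟨x, w⟩ ⟨hx, -⟩
  have h (i : Fin (n + 1)) :
      Continuous fun p : sphere (0 : E) 1 × OrthonormalFrame n (ℂ ∙ (e : E))ᗮ =>
        ((e : E), (p.1 : E), Matrix.vecCons (e : E) (fun j => (p.2.1 j : E)) i) := by
    refine Fin.cases ?_ (fun i => ?_) i <;>
      simp only [Matrix.cons_val_zero, Matrix.cons_val_succ]
    · fun_prop
    · exact continuous_const.prodMk ((continuous_subtype_val.comp continuous_fst).prodMk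
        (continuous_subtype_val.comp ((continuous_apply i).comp
          (continuous_subtype_val.comp continuous_snd))))
  refine ContinuousAt.continuousWithinAt (IsInducing.subtypeVal.continuousAt_iff.2
    (continuousAt_pi.2 fun i => ?_))
  exact ContinuousAt.comp_of_eq (continuousAt_unitReflection (norm_eq_of_mem_sphere e)
    (norm_eq_of_mem_sphere x) (Subtype.coe_ne_coe.2 hx)) (h i).continuousAt rfl

theorem continuousOn_orthonormalFrameSuccEquiv_symm (n : ℕ) (e : sphere (0 : E) 1) :
    ContinuousOn (orthonormalFrameSuccEquiv n e).symm {v | v.1 0 ≠ e} := by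
  intro v hv
  have he := norm_eq_of_mem_sphere e
  have h (i : Fin (n + 1)) : Continuous fun v : OrthonormalFrame (n + 1) E => v.1 i :=
    (continuous_apply i).comp continuous_subtype_val
  refine ContinuousAt.continuousWithinAt (ContinuousAt.prodMk
    ((h 0).subtype_mk _).continuousAt
    (IsInducing.subtypeVal.continuousAt_iff.2 <| continuousAt_pi.2 fun i =>
      IsInducing.subtypeVal.continuousAt_iff.2 ?_))
  have hv' := (continuousAt_unitReflection (y := v.1 i.succ) (v.2.1 0) he (Ne.symm hv)).comp_of_eq
    (f := fun v : OrthonormalFrame (n + 1) E => (v.1 0, (e : E), v.1 i.succ))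
    ((h 0).prodMk (continuous_const.prodMk (h i.succ))).continuousAt rfl
  exact hv'

theorem isOpen_setOf_orthonormalFrame_zero_ne (n : ℕ) (e : E) :
    IsOpen {v : OrthonormalFrame (n + 1) E | v.1 0 ≠ e} :=
  isOpen_ne.preimage ((continuous_apply 0).comp continuous_subtype_val)

/-- The frames whose first vector is not `e` form a trivial bundle over the sphere minus `e`. -/
noncomputable def orthonormalFrameSuccOpenPartialHomeomorph (n : ℕ) (e : sphere (0 : E) 1) :
    OpenPartialHomeomorph (sphere (0 : E) 1 × OrthonormalFrame n (ℂ ∙ (e : E))ᗮ)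
      (OrthonormalFrame (n + 1) E) where
  toFun := orthonormalFrameSuccEquiv n e
  invFun := (orthonormalFrameSuccEquiv n e).symm
  source := {e}ᶜ ×ˢ univ
  target := {v | v.1 0 ≠ e}
  map_source' p hp := by
    rw [mem_ofPred, orthonormalFrameSuccEquiv_zero]
    exact Subtype.coe_ne_coe.2 hp.1
  map_target' v hv := by
    refine ⟨fun h => hv ?_, mem_univ _⟩
    exact congrArg Subtype.val (mem_singleton_iff.1 h)
  left_inv' p _ := (orthonormalFrameSuccEquiv n e).symm_apply_apply p
  right_inv' v _ := (orthonormalFrameSuccEquiv n e).apply_symm_apply v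
  open_source := isOpen_compl_singleton.prod isOpen_univ
  open_target := isOpen_setOf_orthonormalFrame_zero_ne n (e : E)
  continuousOn_toFun := continuousOn_orthonormalFrameSuccEquiv n e
  continuousOn_invFun := continuousOn_orthonormalFrameSuccEquiv_symm n e

theorem isSimplyConnected_setOf_orthonormalFrame_zero_ne (n : ℕ) (e : sphere (0 : E) 1)
    [SimplyConnectedSpace (OrthonormalFrame n (ℂ ∙ (e : E))ᗮ)] :
    IsSimplyConnected {v : OrthonormalFrame (n + 1) E | v.1 0 ≠ e} := by
  let _ : InnerProductSpace ℝ E := InnerProductSpace.complexToReal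
  have := contractibleSpace_compl_singleton_sphere e
  have := SimplyConnectedSpace.prod_of_contractibleSpace ({e}ᶜ : Set (sphere (0 : E) 1))
    (OrthonormalFrame n (ℂ ∙ (e : E))ᗮ)
  have h := (orthonormalFrameSuccOpenPartialHomeomorph n e).toHomeomorphSourceTarget.symm.trans
    ((Homeomorph.Set.prod {e}ᶜ univ).trans
      ((Homeomorph.refl _).prodCongr (Homeomorph.Set.univ _)))
  exact h.toHomotopyEquiv.simplyConnectedSpace

theorem isPathConnected_setOf_orthonormalFrame_zero_ne_and_ne_neg (hE : 1 < finrank ℂ E)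
    (n : ℕ) (e : sphere (0 : E) 1) [PathConnectedSpace (OrthonormalFrame n (ℂ ∙ (e : E))ᗮ)] :
    IsPathConnected {v : OrthonormalFrame (n + 1) E | v.1 0 ≠ e ∧ v.1 0 ≠ -e} := by
  let _ : InnerProductSpace ℝ E := InnerProductSpace.complexToReal
  have hfin : finrank ℝ E = 2 * finrank ℂ E := finrank_real_of_complex E
  have hS := isPathConnected_compl_pair_neg_sphere (by omega) e
  have h := (hS.prod (isPathConnected_univ (X := OrthonormalFrame n (ℂ ∙ (e : E))ᗮ))).image'
    ((continuousOn_orthonormalFrameSuccEquiv n e).mono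
      (prod_mono_left (compl_subset_compl.2 (by simp))))
  convert h using 1
  ext v
  rw [Equiv.image_eq_preimage_symm]
  simp [orthonormalFrameSuccEquiv, Subtype.ext_iff]

/-- The complex Stiefel manifold of orthonormal `n`-frames in a space of dimension greater
than `n` is simply connected. -/
theorem simplyConnectedSpace_orthonormalFrame (n : ℕ) (E : Type*) [NormedAddCommGroup E]
    [InnerProductSpace ℂ E] (hE : n < finrank ℂ E) :
    SimplyConnectedSpace (OrthonormalFrame n E) := by
  induction n generalizing E with
  | zero =>
    have : Nonempty (OrthonormalFrame 0 E) := ⟨⟨Fin.elim0, by simp [Orthonormal, Pairwise]⟩⟩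
    infer_instance
  | succ n ih =>
    have : Fact (finrank ℂ E = (finrank ℂ E - 1) + 1) := ⟨by omega⟩
    have : Nontrivial E := nontrivial_of_finrank_pos (R := ℂ) (by omega)
    obtain ⟨x, hx⟩ := exists_norm_eq E zero_le_one
    let e : sphere (0 : E) 1 := ⟨x, by simpa using hx⟩
    have hfiber (e : sphere (0 : E) 1) :
        SimplyConnectedSpace (OrthonormalFrame n (ℂ ∙ (e : E))ᗮ) := by
      refine ih _ ?_
      rw [Submodule.finrank_orthogonal_span_singleton (n := finrank ℂ E - 1)
        (ne_zero_of_mem_unit_sphere e)]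
      omega
    have hinter := isPathConnected_setOf_orthonormalFrame_zero_ne_and_ne_neg (by omega) n e
    obtain ⟨v, hv, hv'⟩ := hinter.nonempty
    refine .of_iUnion_eq_univ (W := fun b : Bool =>
      {v : OrthonormalFrame (n + 1) E | v.1 0 ≠ ((bif b then e else -e : sphere (0 : E) 1) : E)})
      (fun b => isOpen_setOf_orthonormalFrame_zero_ne n _) ?_
      (fun b => isSimplyConnected_setOf_orthonormalFrame_zero_ne n _) ?_ (x₀ := v) ?_
    · refine eq_univ_of_forall fun v => mem_iUnion.2 ?_
      by_contra! h
      have h1 : v.1 0 = e := by simpa using h true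
      have h2 : v.1 0 = -e := by simpa using h false
      exact ne_neg_of_mem_unit_sphere ℝ e (Subtype.ext (h1.symm.trans h2))
    · rw [ofPred_and] at hinter
      rintro (_ | _) (_ | _) h
      · exact absurd rfl h
      · simpa [inter_comm] using hinter
      · simpa using hinter
      · exact absurd rfl h
    · rintro (_ | _)
      exacts [hv', hv]

end Frames

section Quotient
open Matrix
open scoped InnerProductSpace

instance compactSpace_unitaryGroup (k : ℕ) : CompactSpace (unitaryGroup (Fin k) ℂ) := by
  refine isCompact_iff_compactSpace.1 (IsCompact.of_isClosed_subset
    (isCompact_univ_pi fun _ => isCompact_univ_pi fun _ => isCompact_closedBall (0 : ℂ) 1)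
    (isClosed_unitary (R := Matrix (Fin k) (Fin k) ℂ)) ?_)
  intro U hU i _ j _
  simpa using entry_norm_bound_of_unitary hU i j

theorem inner_toLp_col {k : ℕ} (A B : Matrix (Fin k) (Fin k) ℂ) (i j : Fin k) :
    ⟪WithLp.toLp 2 (A.col i), WithLp.toLp 2 (B.col j)⟫_ℂ = (star A * B) i j := by
  simp [PiLp.inner_apply, Matrix.mul_apply, Matrix.star_apply, mul_comm]

/-- The orthonormal frame formed by the first `n` columns of a unitary matrix. -/
noncomputable def firstColumns (n m : ℕ) (U : unitaryGroup (Fin (n + m)) ℂ) :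
    OrthonormalFrame n (EuclideanSpace ℂ (Fin (n + m))) :=
  ⟨fun i => WithLp.toLp 2 ((U : Matrix _ _ ℂ).col (Fin.castAdd m i)), by
    rw [orthonormal_iff_ite]
    intro i j
    rw [inner_toLp_col, mem_unitaryGroup_iff'.1 U.2, Matrix.one_apply]
    simp⟩

theorem continuous_firstColumns (n m : ℕ) : Continuous (firstColumns n m) := by
  refine Continuous.subtype_mk (continuous_pi fun i =>
    (PiLp.continuous_toLp 2 _).comp (continuous_pi fun j => ?_)) _
  exact continuous_subtype_val.matrix_elem j (Fin.castAdd m i)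

theorem surjective_firstColumns (n m : ℕ) : Function.Surjective (firstColumns n m) := by
  intro v
  let w : Fin (n + m) → EuclideanSpace ℂ (Fin (n + m)) := Fin.append v.1 0
  have hw : Orthonormal ℂ ((range (Fin.castAdd m)).domRestrict w) := by
    rw [orthonormal_iff_ite]
    rintro ⟨_, i, rfl⟩ ⟨_, j, rfl⟩
    have hij : (⟨Fin.castAdd m i, mem_range_self i⟩ : range (Fin.castAdd m)) =
        ⟨Fin.castAdd m j, mem_range_self j⟩ ↔ i = j := by
      simp [Subtype.ext_iff]
    simpa [w, hij] using orthonormal_iff_ite.1 v.2 i j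
  obtain ⟨b, hb⟩ := hw.exists_orthonormalBasis_extension_of_card_eq (by simp)
  refine ⟨⟨Matrix.of fun i j => b j i, mem_unitaryGroup_iff'.2 ?_⟩, ?_⟩
  · ext i j
    rw [← inner_toLp_col, Matrix.one_apply]
    exact orthonormal_iff_ite.1 b.orthonormal i j
  · refine Subtype.ext (funext fun i => ?_)
    have h := hb (Fin.castAdd m i) ⟨i, rfl⟩
    rw [show w (Fin.castAdd m i) = v.1 i from Fin.append_left _ _ _] at h
    rw [← h]
    rfl

theorem mem_blockDiagUnitary_iff {n m : ℕ} {U : unitaryGroup (Fin (n + m)) ℂ} :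
    U ∈ blockDiagUnitary n m ↔
      ∀ (i : Fin (n + m)) (j : Fin n),
        (U : Matrix _ _ ℂ) i (Fin.castAdd m j) = (1 : Matrix _ _ ℂ) i (Fin.castAdd m j) := by
  constructor
  · rintro ⟨A, hA⟩ i j
    rw [hA, Matrix.one_apply]
    have := j.isLt
    simp only [Fin.ext_iff, Fin.val_castAdd]
    split_ifs <;> first | rfl | omega
  · intro h
    have hrow (i : Fin n) (j : Fin (n + m)) :
        (U : Matrix _ _ ℂ) (Fin.castAdd m i) j = (1 : Matrix _ _ ℂ) (Fin.castAdd m i) j := by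
      have hU := congrFun₂ (mem_unitaryGroup_iff'.1 U.2) (Fin.castAdd m i) j
      rw [← hU, Matrix.mul_apply]
      simp [Matrix.star_apply, h, Matrix.one_apply]
    refine ⟨⟨(U : Matrix _ _ ℂ).submatrix (Fin.natAdd n) (Fin.natAdd n),
      mem_unitaryGroup_iff'.2 ?_⟩, fun i j => ?_⟩
    · ext i j
      have hU := congrFun₂ (mem_unitaryGroup_iff'.1 U.2) (Fin.natAdd n i) (Fin.natAdd n j)
      have hne (x : Fin n) (j : Fin m) : (x : ℕ) ≠ n + j := by omega
      rw [Matrix.mul_apply, Fin.sum_univ_add] at hU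
      simpa [Matrix.mul_apply, Matrix.star_apply, hrow, Matrix.one_apply, Fin.ext_iff, hne] using hU
    · split_ifs with hi hij hj
      · exact (hrow ⟨i, hi⟩ j).trans (by simp [Matrix.one_apply, hij])
      · exact (hrow ⟨i, hi⟩ j).trans (by simp [Fin.ext_iff, hij])
      · refine (h i ⟨j, hj⟩).trans (Matrix.one_apply_ne fun hij => hi ?_)
        simp [hij, hj]
      · have hnat (k : Fin (n + m)) (hk : ¬(k : ℕ) < n) :
            Fin.natAdd n (⟨k - n, by omega⟩ : Fin m) = k := by
          simp only [Fin.ext_iff, Fin.val_natAdd]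
          omega
        exact (congrArg₂ (U : Matrix _ _ ℂ) (hnat i hi) (hnat j hj)).symm

theorem firstColumns_eq_iff {n m : ℕ} {g g' : unitaryGroup (Fin (n + m)) ℂ} :
    firstColumns n m g = firstColumns n m g' ↔ stiefelRel n m g g' := by
  have hcols : firstColumns n m g = firstColumns n m g' ↔
      ∀ (i : Fin (n + m)) (j : Fin n),
        (g' : Matrix _ _ ℂ) i (Fin.castAdd m j) = (g : Matrix _ _ ℂ) i (Fin.castAdd m j) := by
    simp [firstColumns, funext_iff, eq_comm, forall_comm (α := Fin n)]
  rw [hcols]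
  constructor
  · intro h
    refine ⟨g⁻¹ * g', mem_blockDiagUnitary_iff.2 fun i j => ?_, by simp⟩
    rw [← mem_unitaryGroup_iff'.1 g.2]
    simp [Matrix.mul_apply, h]
  · rintro ⟨U, hU, rfl⟩ i j
    rw [mem_blockDiagUnitary_iff] at hU
    simp [Matrix.mul_apply, hU, Matrix.one_apply]

/-- The coset space `U(n + m) / U(m)` is the space of orthonormal `n`-frames in `ℂ ^ (n + m)`. -/
noncomputable def stiefelHomeomorph (n m : ℕ) :
    Quot (stiefelRel n m) ≃ₜ OrthonormalFrame n (EuclideanSpace ℂ (Fin (n + m))) :=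
  Continuous.homeoOfEquivCompactToT2 (f := Equiv.ofBijective
    (Quot.lift (firstColumns n m) fun _ _ => firstColumns_eq_iff.2)
    ⟨fun p q => Quot.induction_on₂ p q fun _ _ h => Quot.sound (firstColumns_eq_iff.1 h),
      (Quot.surjective_lift _).2 (surjective_firstColumns n m)⟩)
    (continuous_quot_lift _ (continuous_firstColumns n m))

end Quotient

end SimplyConnected

/-- For `m ≥ 1`, the coset space `U(n+m)/U(m)` (the complex Stiefel manifold), with the
quotient topology, is simply connected. -/
theorem stiefel_simply_connected (n m : ℕ) (hm : 1 ≤ m) :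
    SimplyConnectedSpace (Quot (stiefelRel n m)) := by
  have := simplyConnectedSpace_orthonormalFrame n (EuclideanSpace ℂ (Fin (n + m))) (by simp; omega)
  exact (stiefelHomeomorph n m).toHomotopyEquiv.simplyConnectedSpace
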